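/- There exists a constant c_p > 0 depending only on p such that if ψ̂(0) ≥ c_p·‖ψ‖₂, then there exists a constant C > 0 such that |k̂(1,t)| ≤ C·(T−t)^{(3p−2)/(p+1)} and |k̂(−1,t)| ≤ C·(T−t)^{(3p−2)/(p+1)} for all t ∈ (T/2, T). -/

import Mathlib

open Real MeasureTheory Filter Set

/-- The `n`-th Fourier coefficient of a `2π`-periodic function `f : ℝ → ℝ`:
`f̂(n) = (1/2π) ∫₀^{2π} f(θ) e^{-inθ} dθ`. -/
noncomputable def fCoeff (f : ℝ → ℝ) (n : ℤ) : ℂ :=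
  (1 / (2 * Real.pi)) * ∫ θ in (0:ℝ)..(2 * Real.pi),
    (f θ : ℂ) * Complex.exp (-(Complex.I * n * θ))

/-- The seminorm `‖f‖₂ = max{sup_n n²|Re f̂(n)|, sup_n n²|Im f̂(n)|}`. -/
noncomputable def seminorm2 (f : ℝ → ℝ) : ℝ :=
  max (⨆ n : ℤ, (n : ℝ)^2 * |(fCoeff f n).re|)
      (⨆ n : ℤ, (n : ℝ)^2 * |(fCoeff f n).im|)

/-- The `C^l[0,2π]` norm: `max_{0 ≤ j ≤ l} sup_{θ ∈ [0,2π]} |f^{(j)}(θ)|`. -/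
noncomputable def ClNorm (l : ℕ) (f : ℝ → ℝ) : ℝ :=
  ⨆ j : Fin (l + 1), ⨆ θ : Set.Icc (0:ℝ) (2 * Real.pi),
    |iteratedDeriv (j : ℕ) f (θ : ℝ)|

/-- `k : ℝ × [0,T) → ℝ` is a smooth, `2π`-periodic (in space), strictly positive solution of the
`p`-curve shortening equation
`∂k/∂t = k²(k^{p-1} ∂²k/∂θ² + (p-1) k^{p-2} (∂k/∂θ)² + (1/p) k^p)`
with initial datum `ψ` (smooth, strictly positive, `2π`-periodic), blow-up time `T`
(i.e. `sup_θ k(θ,t) → ∞` as `t → T⁻`), such that `k(·,t)` is the curvature of a simple closed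
convex curve for each `t`, i.e. `∫₀^{2π} e^{iθ}/k(θ,t) dθ = 0`. -/
def IsPCSF (p : ℕ) (T : ℝ) (k : ℝ → ℝ → ℝ) (ψ : ℝ → ℝ) : Prop :=
  ContDiffOn ℝ (⊤ : ℕ∞) (fun q : ℝ × ℝ => k q.1 q.2) (Set.univ ×ˢ Set.Ico 0 T) ∧
  (∀ θ t, k (θ + 2 * Real.pi) t = k θ t) ∧
  (∀ θ : ℝ, ∀ t ∈ Set.Ico (0:ℝ) T, 0 < k θ t) ∧
  (∀ θ : ℝ, ∀ t ∈ Set.Ico (0:ℝ) T,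
    HasDerivAt (fun s => k θ s)
      ((k θ t)^2 * ((k θ t)^(p - 1) * deriv (deriv (fun x => k x t)) θ
        + ((p : ℝ) - 1) * (k θ t)^(p - 2) * (deriv (fun x => k x t) θ)^2
        + (1 / (p : ℝ)) * (k θ t)^p)) t) ∧
  (∀ θ, k θ 0 = ψ θ) ∧
  ContDiff ℝ (⊤ : ℕ∞) ψ ∧ (∀ θ, 0 < ψ θ) ∧ (∀ θ, ψ (θ + 2 * Real.pi) = ψ θ) ∧
  Filter.Tendsto (fun t => ⨆ θ : Set.Icc (0:ℝ) (2 * Real.pi), k (θ : ℝ) t)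
    (nhdsWithin T (Set.Iio T)) Filter.atTop ∧
  (∀ t ∈ Set.Ico (0:ℝ) T,
    (∫ θ in (0:ℝ)..(2 * Real.pi), Complex.exp (Complex.I * θ) / (k θ t)) = 0)

/-- The original time `t` corresponding to the rescaled time `τ`:
`t = T(1 - e^{-(p+1)τ})`, i.e. `τ = -(1/(p+1))·log(1 - t/T)`. -/
noncomputable def tOf (p : ℕ) (T τ : ℝ) : ℝ := T * (1 - Real.exp (-((p : ℝ) + 1) * τ))

/-- The normalized curvature `k̃(θ,τ) = ((p+1)/p)^{1/(p+1)} (T-t)^{1/(p+1)} k(θ,t)`,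
with `t = T(1 - e^{-(p+1)τ})`. -/
noncomputable def ktilde (p : ℕ) (T : ℝ) (k : ℝ → ℝ → ℝ) (θ τ : ℝ) : ℝ :=
  (((p : ℝ) + 1) / (p : ℝ)) ^ ((1 : ℝ) / ((p : ℝ) + 1))
    * (T - tOf p T τ) ^ ((1 : ℝ) / ((p : ℝ) + 1)) * k θ (tOf p T τ)

theorem sq_intervalIntegral_le {g : ℝ → ℝ} (hg : Continuous g) {a b : ℝ} (hab : a < b) :
    (∫ x in a..b, g x) ^ 2 ≤ (b - a) * ∫ x in a..b, g x ^ 2 := by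
  have hb : 0 < b - a := sub_pos.2 hab
  set c := (∫ x in a..b, g x) / (b - a) with hc
  have h0 : 0 ≤ ∫ x in a..b, (g x - c) ^ 2 :=
    intervalIntegral.integral_nonneg hab.le fun x _ => sq_nonneg _
  have h1 : ∫ x in a..b, (g x - c) ^ 2
      = (∫ x in a..b, g x ^ 2) - 2 * c * (∫ x in a..b, g x) + (b - a) * c ^ 2 := by
    have : ∀ x, (g x - c) ^ 2 = g x ^ 2 - 2 * c * g x + c ^ 2 := fun x => by ring
    simp_rw [this]
    rw [intervalIntegral.integral_add, intervalIntegral.integral_sub,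
      intervalIntegral.integral_const_mul, intervalIntegral.integral_const, smul_eq_mul]
    all_goals apply Continuous.intervalIntegrable; fun_prop
  have h2 : (∫ x in a..b, g x) = c * (b - a) := by rw [hc]; field_simp
  rw [h1, h2] at h0
  rw [h2]
  nlinarith

theorem sq_sub_le_integral_deriv_sq {f f' : ℝ → ℝ} (hf : ∀ x, HasDerivAt f (f' x) x)
    (hf' : Continuous f') {a b x y : ℝ} (hab : a < b) (hx : x ∈ Icc a b) (hy : y ∈ Icc a b) :
    (f x - f y) ^ 2 ≤ (b - a) * ∫ z in a..b, f' z ^ 2 := by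
  wlog h : y ≤ x generalizing x y
  · rw [← neg_sub, neg_sq]
    exact this hy hx (le_of_not_ge h)
  have hint : ∀ u v : ℝ, IntervalIntegrable (fun z => f' z ^ 2) volume u v := fun u v =>
    (hf'.pow 2).intervalIntegrable _ _
  have hnn : 0 ≤ ∫ z in a..b, f' z ^ 2 :=
    intervalIntegral.integral_nonneg hab.le fun x _ => sq_nonneg _
  rcases h.eq_or_lt with h | h
  · simpa [h] using mul_nonneg (sub_pos.2 hab).le hnn
  have h1 : ∫ z in y..x, f' z = f x - f y :=
    intervalIntegral.integral_eq_sub_of_hasDerivAt (fun z _ => hf z)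
      (hf'.intervalIntegrable _ _)
  have h2 := sq_intervalIntegral_le hf' h
  have h3 : ∫ z in y..x, f' z ^ 2 ≤ ∫ z in a..b, f' z ^ 2 :=
    intervalIntegral.integral_mono_interval hy.1 h.le hx.2
      (Eventually.of_forall fun z => sq_nonneg _) (hint _ _)
  rw [h1] at h2
  have h4 : 0 ≤ ∫ z in y..x, f' z ^ 2 :=
    intervalIntegral.integral_nonneg h.le fun x _ => sq_nonneg _
  refine h2.trans (mul_le_mul (by linarith [hx.2, hy.1]) h3 h4 (sub_pos.2 hab).le)

theorem sq_sub_average_le_integral_deriv_sq {f f' : ℝ → ℝ} (hf : ∀ x, HasDerivAt f (f' x) x)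
    (hf' : Continuous f') {L x : ℝ} (hL : ∫ θ in (0:ℝ)..(2 * π), f θ = 2 * π * L)
    (hx : x ∈ Icc 0 (2 * π)) :
    (f x - L) ^ 2 ≤ 2 * π * ∫ z in (0:ℝ)..(2 * π), f' z ^ 2 := by
  have hpi : (0:ℝ) < 2 * π := by positivity
  have hc : Continuous f := continuous_iff_continuousAt.2 fun x => (hf x).continuousAt
  obtain ⟨y, hy, hfy⟩ := exists_eq_interval_average (f := f) hpi.ne hc.continuousOn
  rw [interval_average_eq_div, hL] at hfy
  have hfy' : f y = L := by rw [hfy, sub_zero, mul_div_cancel_left₀ _ hpi.ne']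
  have hy' : y ∈ Icc 0 (2 * π) := by
    rw [uIoo_of_le hpi.le] at hy
    exact Ioo_subset_Icc_self hy
  have := sq_sub_le_integral_deriv_sq hf hf' hpi hx hy'
  rwa [hfy', sub_zero] at this

theorem integral_deriv_eq_zero_of_periodic {f f' : ℝ → ℝ} (hf : ∀ x, HasDerivAt f (f' x) x)
    (hf' : Continuous f') (hper : ∀ x, f (x + 2 * π) = f x) :
    ∫ θ in (0:ℝ)..(2 * π), f' θ = 0 := by
  rw [intervalIntegral.integral_eq_sub_of_hasDerivAt (fun z _ => hf z)
    (hf'.intervalIntegrable _ _)]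
  have := hper 0
  rw [zero_add] at this
  rw [this, sub_self]

theorem fCoeff_eq_fourierCoeffOn (f : ℝ → ℝ) (n : ℤ) :
    fCoeff f n = fourierCoeffOn (two_pi_pos) (fun x => (f x : ℂ)) n := by
  rw [fourierCoeffOn_eq_integral, fCoeff]
  simp only [sub_zero, fourier_coe_apply, smul_eq_mul, Complex.real_smul]
  push_cast
  congr 1
  refine intervalIntegral.integral_congr fun x _ => ?_
  rw [mul_comm]
  congr 2
  have : (π : ℂ) ≠ 0 := by exact_mod_cast pi_ne_zero
  field_simp

theorem fCoeff_deriv {f f' : ℝ → ℝ} (hf : ∀ x, HasDerivAt f (f' x) x)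
    (hf' : Continuous f') (hper : ∀ x, f (x + 2 * π) = f x) (n : ℤ) :
    fCoeff f' n = Complex.I * n * fCoeff f n := by
  rcases eq_or_ne n 0 with rfl | hn
  · have := integral_deriv_eq_zero_of_periodic hf hf' hper
    simp [fCoeff, intervalIntegral.integral_ofReal, this]
  · have h := fourierCoeffOn_of_hasDerivAt two_pi_pos (n := n) hn (f := fun x => (f x : ℂ))
      (f' := fun x => (f' x : ℂ)) (fun x _ => (hf x).ofReal_comp)
      ((Complex.continuous_ofReal.comp hf').intervalIntegrable _ _)
    have h0 := hper 0
    rw [zero_add] at h0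
    rw [← fCoeff_eq_fourierCoeffOn, ← fCoeff_eq_fourierCoeffOn, h0] at h
    rw [h]
    have : (π : ℂ) ≠ 0 := by exact_mod_cast pi_ne_zero
    have hn' : (n : ℂ) ≠ 0 := by exact_mod_cast hn
    push_cast
    field_simp
    ring_nf

theorem hasSum_sq_fCoeff {f : ℝ → ℝ} (hf : Continuous f) :
    HasSum (fun n : ℤ => ‖fCoeff f n‖ ^ 2) ((2 * π)⁻¹ * ∫ x in (0:ℝ)..(2 * π), f x ^ 2) := by
  have hc : Continuous (fun x => (f x : ℂ)) := Complex.continuous_ofReal.comp hf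
  obtain ⟨C, hC⟩ := isCompact_Icc.exists_bound_of_continuousOn (s := Icc 0 (2 * π))
    hc.continuousOn
  have h := hasSum_sq_fourierCoeffOn (f := fun x => (f x : ℂ)) two_pi_pos
    (MemLp.of_bound hc.aestronglyMeasurable C
      (ae_restrict_of_forall_mem measurableSet_Ioc fun x hx => hC x (Ioc_subset_Icc_self hx)))
  simp_rw [fCoeff_eq_fourierCoeffOn]
  simpa using h

/-- The Wirtinger inequality for functions without the Fourier modes `±1`. -/
theorem four_mul_integral_deriv_sq_le {f f' f'' : ℝ → ℝ} (hf : ∀ x, HasDerivAt f (f' x) x)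
    (hf' : ∀ x, HasDerivAt f' (f'' x) x) (hf'' : Continuous f'')
    (hper : ∀ x, f (x + 2 * π) = f x) (hper' : ∀ x, f' (x + 2 * π) = f' x)
    (h1 : fCoeff f 1 = 0) (h2 : fCoeff f (-1) = 0) :
    4 * ∫ x in (0:ℝ)..(2 * π), f' x ^ 2 ≤ ∫ x in (0:ℝ)..(2 * π), f'' x ^ 2 := by
  have hc : Continuous f' := continuous_iff_continuousAt.2 fun x => (hf' x).continuousAt
  have key := hasSum_le (fun n : ℤ => ?_) ((hasSum_sq_fCoeff hc).mul_left 4)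
    (hasSum_sq_fCoeff hf'')
  · have : (0:ℝ) < (2 * π)⁻¹ := by positivity
    rw [mul_left_comm] at key
    exact le_of_mul_le_mul_left key this
  · rw [fCoeff_deriv hf' hf'' hper' n, norm_mul, mul_pow]
    have hI : ‖Complex.I * (n : ℂ)‖ ^ 2 = (n : ℝ) ^ 2 := by simp
    rw [hI]
    by_cases hn : n = 0 ∨ n = 1 ∨ n = -1
    · have : fCoeff f' n = 0 := by
        rw [fCoeff_deriv hf hc hper]
        rcases hn with rfl | rfl | rfl <;> simp [h1, h2]
      simp [this]
    · push Not at hn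
      have h4 : (4:ℤ) ≤ n ^ 2 := by
        have : 2 ≤ n ∨ n ≤ -2 := by omega
        rcases this with h | h <;> nlinarith
      exact mul_le_mul_of_nonneg_right (by exact_mod_cast h4) (sq_nonneg _)

theorem norm_sq_fCoeff_deriv_le {f f' f'' : ℝ → ℝ} (hf : ∀ x, HasDerivAt f (f' x) x)
    (hf' : ∀ x, HasDerivAt f' (f'' x) x) (hf'' : Continuous f'')
    (hper : ∀ x, f (x + 2 * π) = f x) (hper' : ∀ x, f' (x + 2 * π) = f' x) (n : ℤ) :
    ‖fCoeff f' n‖ ^ 2 ≤ 2 * seminorm2 f ^ 2 * (1 / (n:ℝ) ^ 2) := by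
  have hc : Continuous f' := continuous_iff_continuousAt.2 fun x => (hf' x).continuousAt
  have hcoef : ∀ n, fCoeff f'' n = -((n : ℝ) ^ 2 : ℝ) * fCoeff f n := fun n => by
    rw [fCoeff_deriv hf' hf'' hper', fCoeff_deriv hf hc hper, ← mul_assoc]
    congr 1
    push_cast
    linear_combination (n : ℂ) ^ 2 * Complex.I_sq
  obtain ⟨K, hK⟩ : ∃ K, ∀ n, ‖fCoeff f'' n‖ ≤ K := by
    have hs := hasSum_sq_fCoeff hf''
    refine ⟨Real.sqrt _, fun n => Real.le_sqrt_of_sq_le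
      (le_hasSum hs n fun m _ => sq_nonneg _)⟩
  have hre : ∀ n : ℤ, (n:ℝ) ^ 2 * |(fCoeff f n).re| = |(fCoeff f'' n).re| := fun n => by
    rw [hcoef, ← Complex.ofReal_neg, Complex.re_ofReal_mul, abs_mul, abs_neg, abs_sq]
  have him : ∀ n : ℤ, (n:ℝ) ^ 2 * |(fCoeff f n).im| = |(fCoeff f'' n).im| := fun n => by
    rw [hcoef, ← Complex.ofReal_neg, Complex.im_ofReal_mul, abs_mul, abs_neg, abs_sq]
  have b1 : (n:ℝ) ^ 2 * |(fCoeff f n).re| ≤ seminorm2 f := by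
    refine le_max_of_le_left (le_ciSup (f := fun n : ℤ => (n:ℝ) ^ 2 * |(fCoeff f n).re|) ?_ n)
    refine ⟨K, ?_⟩
    rintro _ ⟨m, rfl⟩
    simp only [hre]
    exact (Complex.abs_re_le_norm _).trans (hK m)
  have b2 : (n:ℝ) ^ 2 * |(fCoeff f n).im| ≤ seminorm2 f := by
    refine le_max_of_le_right (le_ciSup (f := fun n : ℤ => (n:ℝ) ^ 2 * |(fCoeff f n).im|) ?_ n)
    refine ⟨K, ?_⟩
    rintro _ ⟨m, rfl⟩
    simp only [him]
    exact (Complex.abs_im_le_norm _).trans (hK m)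
  rcases eq_or_ne n 0 with rfl | hn
  · simp [fCoeff_deriv hf hc hper]
  have hn' : (0:ℝ) < (n:ℝ) ^ 2 := by positivity
  rw [mul_one_div, le_div_iff₀ hn', fCoeff_deriv hf hc hper, norm_mul, mul_pow]
  have hI : ‖Complex.I * (n : ℂ)‖ ^ 2 = (n : ℝ) ^ 2 := by simp
  rw [hI, ← Complex.normSq_eq_norm_sq, Complex.normSq_apply]
  have c1 := pow_le_pow_left₀ (by positivity) b1 2
  have c2 := pow_le_pow_left₀ (by positivity) b2 2
  rw [mul_pow, sq_abs] at c1 c2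
  linarith

theorem integral_deriv_sq_le_seminorm2_sq {f f' f'' : ℝ → ℝ} (hf : ∀ x, HasDerivAt f (f' x) x)
    (hf' : ∀ x, HasDerivAt f' (f'' x) x) (hf'' : Continuous f'')
    (hper : ∀ x, f (x + 2 * π) = f x) (hper' : ∀ x, f' (x + 2 * π) = f' x) :
    ∫ x in (0:ℝ)..(2 * π), f' x ^ 2
      ≤ 4 * π * (∑' n : ℤ, 1 / (n:ℝ) ^ 2) * seminorm2 f ^ 2 := by
  have hc : Continuous f' := continuous_iff_continuousAt.2 fun x => (hf' x).continuousAt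
  have hs : Summable fun n : ℤ => 1 / (n:ℝ) ^ 2 := Real.summable_one_div_int_pow.2 one_lt_two
  have key := hasSum_le (norm_sq_fCoeff_deriv_le hf hf' hf'' hper hper') (hasSum_sq_fCoeff hc)
    (hs.hasSum.mul_left (2 * seminorm2 f ^ 2))
  rw [inv_mul_le_iff₀ two_pi_pos] at key
  linarith

/-- Closeness to `1` that keeps the powers `x⁻¹ ^ j`, `j ≤ p + 3`, within `1 / 20` of `1`. -/
theorem exists_pinching_const (p : ℕ) : ∃ δ > (0:ℝ), 2100 * ((p:ℝ) + 1) ^ 2 * δ ≤ 1 ∧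
    ∀ x : ℝ, (x - 1) ^ 2 ≤ δ → 1 / 2 ≤ x ∧ ∀ j ∈ Finset.range (p + 4), |x⁻¹ ^ j - 1| ≤ 1 / 20 := by
  have h1 : ∀ᶠ x in nhds (1:ℝ), 1 / 2 ≤ x ∧ ∀ j ∈ Finset.range (p + 4), |x⁻¹ ^ j - 1| ≤ 1 / 20 := by
    refine (eventually_ge_nhds (by norm_num)).and ((Finset.eventually_all _).2 fun j _ => ?_)
    have hc : ContinuousAt (fun x : ℝ => |x⁻¹ ^ j - 1|) 1 :=
      (((continuousAt_inv₀ one_ne_zero).pow j).sub continuousAt_const).abs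
    exact hc.eventually (eventually_le_nhds (by norm_num))
  obtain ⟨ε, hε, h⟩ := Metric.eventually_nhds_iff.1 h1
  refine ⟨min (ε ^ 2 / 4) (2100 * ((p:ℝ) + 1) ^ 2)⁻¹, by positivity, ?_, fun x hx => h ?_⟩
  · calc _ ≤ 2100 * ((p:ℝ) + 1) ^ 2 * (2100 * ((p:ℝ) + 1) ^ 2)⁻¹ := by
          gcongr
          exact min_le_right _ _
      _ = 1 := mul_inv_cancel₀ (by positivity)
  · have h2 : (x - 1) ^ 2 ≤ (ε / 2) ^ 2 :=
      hx.trans ((min_le_left _ _).trans (by linarith [div_pow ε 2 2]))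
    have := abs_le_of_sq_le_sq h2 (by positivity)
    rw [Real.dist_eq]
    exact this.trans_lt (by linarith)

theorem pow_inv_bounds {p : ℕ} {δ : ℝ}
    (hδ : ∀ x : ℝ, (x - 1) ^ 2 ≤ δ → 1 / 2 ≤ x ∧ ∀ j ∈ Finset.range (p + 4), |x⁻¹ ^ j - 1| ≤ 1 / 20)
    {L y : ℝ} (hL : 0 < L) (hy : (y - L) ^ 2 ≤ δ * L ^ 2) :
    L / 2 ≤ y ∧ ∀ j < p + 4, 19 / 20 * L⁻¹ ^ j ≤ y⁻¹ ^ j ∧ y⁻¹ ^ j ≤ 21 / 20 * L⁻¹ ^ j := by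
  have hx : (y / L - 1) ^ 2 ≤ δ := by
    rw [div_sub_one hL.ne', div_pow, div_le_iff₀ (by positivity)]
    exact hy
  obtain ⟨h1, h2⟩ := hδ _ hx
  rw [le_div_iff₀ hL] at h1
  refine ⟨by linarith, fun j hj => ?_⟩
  have h3 := abs_le.1 (h2 j (Finset.mem_range.2 hj))
  have h4 : y⁻¹ ^ j = (y / L)⁻¹ ^ j * L⁻¹ ^ j := by
    rw [← mul_pow, inv_div, div_mul_eq_mul_div, mul_inv_cancel₀ hL.ne', one_div]
  have h5 : 0 < L⁻¹ ^ j := by positivity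
  rw [h4]
  constructor <;> nlinarith [h3.1, h3.2]

/-- The right-hand side of the evolution equation `∂m/∂t = -(1/p) (∂²(m⁻ᵖ)/∂θ² + m⁻ᵖ)` for the radius
of curvature `m = 1/k`, in terms of the values of `m` and its space derivatives. -/
noncomputable def radiusSpeed (p : ℕ) (m m' m'' : ℝ) : ℝ :=
  m⁻¹ ^ (p + 1) * m'' - (p + 1) * m⁻¹ ^ (p + 2) * m' ^ 2 - 1 / p * m⁻¹ ^ p

section Slice

variable {p : ℕ} {m m' m'' : ℝ → ℝ}

theorem continuous_inv_pow_of_pos (hm : ∀ x, HasDerivAt m (m' x) x) (hpos : ∀ x, 0 < m x) (j : ℕ) :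
    Continuous fun x => (m x)⁻¹ ^ j :=
  ((continuous_iff_continuousAt.2 fun x => (hm x).continuousAt).inv₀ fun x => (hpos x).ne').pow j

theorem integral_radiusSpeed (hm : ∀ x, HasDerivAt m (m' x) x)
    (hm' : ∀ x, HasDerivAt m' (m'' x) x) (hm'' : Continuous m'') (hpos : ∀ x, 0 < m x)
    (hper : ∀ x, m (x + 2 * π) = m x) (hper' : ∀ x, m' (x + 2 * π) = m' x) :
    ∫ θ in (0:ℝ)..(2 * π), radiusSpeed p (m θ) (m' θ) (m'' θ)
      = -(1 / p * ∫ θ in (0:ℝ)..(2 * π), (m θ)⁻¹ ^ p) := by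
  have hc := continuous_inv_pow_of_pos hm hpos
  have hc' : Continuous m' := continuous_iff_continuousAt.2 fun x => (hm' x).continuousAt
  have hF : ∀ x, HasDerivAt (fun x => (m x)⁻¹ ^ (p + 1) * m' x)
      ((m x)⁻¹ ^ (p + 1) * m'' x - (p + 1) * (m x)⁻¹ ^ (p + 2) * m' x ^ 2) x := fun x => by
    refine ((((hm x).fun_inv (hpos x).ne').fun_pow (p + 1)).fun_mul (hm' x)).congr_deriv ?_
    have := (hpos x).ne'
    push_cast
    rw [pow_add _ p 2, pow_add _ p 1]
    field_simp
    ring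
  have h0 := integral_deriv_eq_zero_of_periodic hF
    (by have := hc (p + 1); have := hc (p + 2); fun_prop) (fun x => by simp only [hper, hper'])
  simp only [radiusSpeed]
  rw [intervalIntegral.integral_sub, h0, intervalIntegral.integral_const_mul, zero_sub]
  all_goals
    apply Continuous.intervalIntegrable
    have := hc (p + 1); have := hc (p + 2); have := hc p
    fun_prop

theorem integral_inv_pow_mul_deriv_deriv (hm : ∀ x, HasDerivAt m (m' x) x)
    (hm' : ∀ x, HasDerivAt m' (m'' x) x) (hm'' : Continuous m'') (hpos : ∀ x, 0 < m x)
    (hper : ∀ x, m (x + 2 * π) = m x) (hper' : ∀ x, m' (x + 2 * π) = m' x) :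
    ∫ θ in (0:ℝ)..(2 * π), (m θ)⁻¹ ^ p * m'' θ
      = p * ∫ θ in (0:ℝ)..(2 * π), (m θ)⁻¹ ^ (p + 1) * m' θ ^ 2 := by
  have hc := continuous_inv_pow_of_pos hm hpos
  have hc' : Continuous m' := continuous_iff_continuousAt.2 fun x => (hm' x).continuousAt
  have hF : ∀ x, HasDerivAt (fun x => (m x)⁻¹ ^ p * m' x)
      ((m x)⁻¹ ^ p * m'' x - p * ((m x)⁻¹ ^ (p + 1) * m' x ^ 2)) x := fun x => by
    refine ((((hm x).fun_inv (hpos x).ne').fun_pow p).fun_mul (hm' x)).congr_deriv ?_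
    have := (hpos x).ne'
    rcases p with _ | p
    · simp
    rw [add_tsub_cancel_right, pow_add _ p 1, pow_add _ (p + 1) 1, pow_add _ p 1]
    field_simp
    ring
  have c1 : Continuous fun θ => (m θ)⁻¹ ^ p * m'' θ := (hc p).mul hm''
  have c2 : Continuous fun θ => (p:ℝ) * ((m θ)⁻¹ ^ (p + 1) * m' θ ^ 2) :=
    ((hc (p + 1)).mul (hc'.pow 2)).const_mul _
  have h0 := integral_deriv_eq_zero_of_periodic hF (c1.sub c2)
    (fun x => by simp only [hper, hper'])
  rw [intervalIntegral.integral_sub (c1.intervalIntegrable _ _) (c2.intervalIntegrable _ _),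
    intervalIntegral.integral_const_mul] at h0
  linarith

/-- The energy dissipation estimate: `∫ (∂m/∂θ)²` decays at rate `5.1 L⁻⁽ᵖ⁺¹⁾` near a circle. -/
theorem integral_neg_deriv_deriv_mul_radiusSpeed_le (hp : 1 ≤ p)
    (hm : ∀ x, HasDerivAt m (m' x) x)
    (hm' : ∀ x, HasDerivAt m' (m'' x) x) (hm'' : Continuous m'') (hpos : ∀ x, 0 < m x)
    (hper : ∀ x, m (x + 2 * π) = m x) (hper' : ∀ x, m' (x + 2 * π) = m' x)
    (h1 : fCoeff m 1 = 0) (h2 : fCoeff m (-1) = 0) {L δ : ℝ} (hL : 0 < L)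
    (hδp : 2100 * ((p:ℝ) + 1) ^ 2 * δ ≤ 1)
    (hbd : ∀ x ∈ Icc 0 (2 * π), ∀ j < p + 4,
      19 / 20 * L⁻¹ ^ j ≤ (m x)⁻¹ ^ j ∧ (m x)⁻¹ ^ j ≤ 21 / 20 * L⁻¹ ^ j)
    (hA : 2 * π * ∫ θ in (0:ℝ)..(2 * π), m' θ ^ 2 ≤ δ * L ^ 2) :
    -2 * ∫ θ in (0:ℝ)..(2 * π), m'' θ * radiusSpeed p (m θ) (m' θ) (m'' θ)
      ≤ -(51 / 10) * L⁻¹ ^ (p + 1) * ∫ θ in (0:ℝ)..(2 * π), m' θ ^ 2 := by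
  have hc := continuous_inv_pow_of_pos hm hpos
  have hc' : Continuous m' := continuous_iff_continuousAt.2 fun x => (hm' x).continuousAt
  have hW := four_mul_integral_deriv_sq_le hm hm' hm'' hper hper' h1 h2
  have hibp := integral_inv_pow_mul_deriv_deriv (p := p) hm hm' hm'' hpos hper hper'
  have hsup : ∀ x ∈ Icc 0 (2 * π), m' x ^ 2 ≤ 2 * π * ∫ z in (0:ℝ)..(2 * π), m'' z ^ 2 :=
    fun x hx => by
      have h0 := integral_deriv_eq_zero_of_periodic hm hc' hper
      simpa using sq_sub_average_le_integral_deriv_sq hm' hm'' (L := 0) (by simpa using h0) hx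
  set A := ∫ θ in (0:ℝ)..(2 * π), m' θ ^ 2 with hAdef
  set B := ∫ θ in (0:ℝ)..(2 * π), m'' θ ^ 2 with hBdef
  have hB0 : 0 ≤ B := intervalIntegral.integral_nonneg two_pi_pos.le fun x _ => sq_nonneg _
  have hA0 : 0 ≤ A := intervalIntegral.integral_nonneg two_pi_pos.le fun x _ => sq_nonneg _
  have hp0 : (p:ℝ) ≠ 0 := by positivity
  have cq : Continuous fun θ => (m θ)⁻¹ ^ p * m'' θ := (hc p).mul hm''
  have cr : Continuous fun θ => (m θ)⁻¹ ^ (p + 1) * m' θ ^ 2 := (hc (p + 1)).mul (hc'.pow 2)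
  have cs : Continuous fun θ => -2 * ((m θ)⁻¹ ^ (p + 1) * m'' θ ^ 2)
      + 2 * ((p + 1) * (m θ)⁻¹ ^ (p + 2) * m' θ ^ 2 * m'' θ) := by
    have := hc (p + 1); have := hc (p + 2)
    fun_prop
  have e1 : -2 * ∫ θ in (0:ℝ)..(2 * π), m'' θ * radiusSpeed p (m θ) (m' θ) (m'' θ)
      = ∫ θ in (0:ℝ)..(2 * π), (-2 * ((m θ)⁻¹ ^ (p + 1) * m'' θ ^ 2)
      + 2 * ((p + 1) * (m θ)⁻¹ ^ (p + 2) * m' θ ^ 2 * m'' θ)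
      + 2 * ((m θ)⁻¹ ^ (p + 1) * m' θ ^ 2)) := by
    rw [intervalIntegral.integral_add (cs.intervalIntegrable _ _)
      ((cr.const_mul 2).intervalIntegrable _ _), intervalIntegral.integral_const_mul 2,
      ← mul_right_inj' hp0, mul_add, mul_left_comm _ (2:ℝ), ← hibp,
      ← intervalIntegral.integral_const_mul, ← intervalIntegral.integral_const_mul,
      ← intervalIntegral.integral_const_mul, ← intervalIntegral.integral_const_mul,
      ← intervalIntegral.integral_add ((cs.const_mul _).intervalIntegrable _ _)
      ((cq.const_mul 2).intervalIntegrable _ _)]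
    refine intervalIntegral.integral_congr fun θ _ => ?_
    simp only [radiusSpeed]
    field_simp
    ring
  set l := L⁻¹ with hl
  have hl0 : 0 < l := inv_pos.2 hL
  have e2 : ∀ θ ∈ Icc 0 (2 * π), (-2 * ((m θ)⁻¹ ^ (p + 1) * m'' θ ^ 2)
      + 2 * ((p + 1) * (m θ)⁻¹ ^ (p + 2) * m' θ ^ 2 * m'' θ)
      + 2 * ((m θ)⁻¹ ^ (p + 1) * m' θ ^ 2))
      ≤ -(361 / 200) * l ^ (p + 1) * m'' θ ^ 2
        + (21 / 2 * (p + 1) ^ 2 * l ^ (p + 3) * (2 * π * B) + 21 / 10 * l ^ (p + 1))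
          * m' θ ^ 2 := by
    intro θ hθ
    obtain ⟨b1, b2⟩ := hbd θ hθ (p + 1) (by omega)
    obtain ⟨-, b3⟩ := hbd θ hθ (p + 3) (by omega)
    have hs := hsup θ hθ
    have hk : 0 < (m θ)⁻¹ := inv_pos.2 (hpos θ)
    set K := (m θ)⁻¹
    have hK1 : 0 < K ^ (p + 1) := by positivity
    have y1 : 2 * ((p + 1) * K ^ (p + 2) * m' θ ^ 2 * m'' θ)
        ≤ 1 / 10 * (K ^ (p + 1) * m'' θ ^ 2) + 10 * (p + 1) ^ 2 * K ^ (p + 3) * m' θ ^ 4 := by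
      have : 0 ≤ K ^ (p + 1) * (m'' θ - 10 * (p + 1) * K * m' θ ^ 2) ^ 2 := by positivity
      have h2 : K ^ (p + 2) = K ^ (p + 1) * K := by ring
      have h3 : K ^ (p + 3) = K ^ (p + 1) * K ^ 2 := by ring
      rw [h2, h3]
      linarith
    have y2 : K ^ (p + 3) * m' θ ^ 4 ≤ 21 / 20 * l ^ (p + 3) * (2 * π * B * m' θ ^ 2) := by
      refine mul_le_mul b3 ?_ (by positivity) (by positivity)
      calc m' θ ^ 4 = m' θ ^ 2 * m' θ ^ 2 := by ring
        _ ≤ _ := by gcongr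
    have y3 : 10 * ((p:ℝ) + 1) ^ 2 * (K ^ (p + 3) * m' θ ^ 4)
        ≤ 10 * (p + 1) ^ 2 * (21 / 20 * l ^ (p + 3) * (2 * π * B * m' θ ^ 2)) := by gcongr
    have y4 : K ^ (p + 1) * m' θ ^ 2 ≤ 21 / 20 * l ^ (p + 1) * m' θ ^ 2 := by gcongr
    have y5 : 19 / 20 * l ^ (p + 1) * m'' θ ^ 2 ≤ K ^ (p + 1) * m'' θ ^ 2 := by gcongr
    linarith
  have ca : Continuous fun θ => m'' θ ^ 2 := hm''.pow 2
  have cb : Continuous fun θ => m' θ ^ 2 := hc'.pow 2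
  have e3 := intervalIntegral.integral_mono_on (μ := volume) two_pi_pos.le
    ((cs.fun_add (cr.const_mul 2)).intervalIntegrable _ _)
    (((ca.const_mul (-(361 / 200) * l ^ (p + 1))).fun_add (cb.const_mul (21 / 2 * (p + 1) ^ 2
      * l ^ (p + 3) * (2 * π * B) + 21 / 10 * l ^ (p + 1)))).intervalIntegrable _ _) e2
  rw [intervalIntegral.integral_add ((ca.const_mul _).intervalIntegrable _ _)
    ((cb.const_mul _).intervalIntegrable _ _), intervalIntegral.integral_const_mul,
    intervalIntegral.integral_const_mul, ← hAdef, ← hBdef] at e3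
  rw [e1]
  refine e3.trans ?_
  have e4 : 21 / 2 * ((p:ℝ) + 1) ^ 2 * l ^ (p + 3) * (2 * π * B) * A
      ≤ 1 / 200 * (l ^ (p + 1) * B) := by
    have hlL : l ^ 2 * L ^ 2 = 1 := by rw [hl, ← mul_pow, inv_mul_cancel₀ hL.ne', one_pow]
    calc _ = 21 / 2 * ((p:ℝ) + 1) ^ 2 * l ^ (p + 3) * B * (2 * π * A) := by ring
      _ ≤ 21 / 2 * ((p:ℝ) + 1) ^ 2 * l ^ (p + 3) * B * (δ * L ^ 2) := by gcongr
      _ = 1 / 200 * (l ^ (p + 1) * B) * (2100 * ((p:ℝ) + 1) ^ 2 * δ) * (l ^ 2 * L ^ 2) := by ring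
      _ ≤ 1 / 200 * (l ^ (p + 1) * B) * 1 * 1 := by rw [hlL]; gcongr
      _ = _ := by ring
  have e5 : l ^ (p + 1) * (4 * A) ≤ l ^ (p + 1) * B := by gcongr
  have e6 : 0 ≤ l ^ (p + 1) * A := by positivity
  linarith

end Slice

/-- The mode `±1` of the curvature `1/m` is quadratic in the oscillation of `m`. -/
theorem norm_fCoeff_inv_le {m : ℝ → ℝ} (hc : Continuous m) {L D : ℝ} (hL : 0 < L)
    (hlow : ∀ x ∈ Icc 0 (2 * π), L / 2 ≤ m x) (hosc : ∀ x ∈ Icc 0 (2 * π), (m x - L) ^ 2 ≤ D)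
    {n : ℤ} (hn : n ≠ 0) (h : fCoeff m n = 0) :
    ‖fCoeff (fun x => (m x)⁻¹) n‖ ≤ 2 * D / L ^ 3 := by
  have hLc : (L : ℂ) ≠ 0 := by exact_mod_cast hL.ne'
  have hpi : (π : ℂ) ≠ 0 := by exact_mod_cast pi_ne_zero
  set e : ℝ → ℂ := fun θ => Complex.exp (-(Complex.I * n * θ)) with he
  have hec : Continuous e := by fun_prop
  have hmc : Continuous fun x => (m x : ℂ) := Complex.continuous_ofReal.comp hc
  have hm0 : ∫ θ in (0:ℝ)..(2 * π), (m θ : ℂ) * e θ = 0 := by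
    simp only [fCoeff] at h
    exact (mul_eq_zero.1 h).resolve_left (by simp [hpi])
  have he0 : ∫ θ in (0:ℝ)..(2 * π), e θ = 0 := by
    have h1 := fCoeff_deriv (f := fun _ => 1) (f' := fun _ => 0) (fun x => hasDerivAt_const x 1)
      continuous_const (fun _ => rfl) n
    have hn' : (n : ℂ) ≠ 0 := by exact_mod_cast hn
    simpa [fCoeff, hn', hpi] using h1
  have heq : ∫ θ in (0:ℝ)..(2 * π), (((m θ)⁻¹ : ℝ) : ℂ) * e θ
      = ∫ θ in (0:ℝ)..(2 * π), (((m θ - L) ^ 2 * (m θ)⁻¹ / L ^ 2 : ℝ) : ℂ) * e θ := by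
    have h3 : ∫ θ in (0:ℝ)..(2 * π),
        ((2 / L : ℂ) * e θ - (1 / L ^ 2 : ℂ) * ((m θ : ℂ) * e θ)) = 0 := by
      rw [intervalIntegral.integral_sub, intervalIntegral.integral_const_mul,
        intervalIntegral.integral_const_mul, he0, hm0]
      · simp
      all_goals apply Continuous.intervalIntegrable; fun_prop
    have hne : ∀ x ∈ Icc 0 (2 * π), m x ≠ 0 := fun x hx =>
      (lt_of_lt_of_le (half_pos hL) (hlow x hx)).ne'
    rw [← sub_eq_zero, ← intervalIntegral.integral_sub, ← h3]
    · refine intervalIntegral.integral_congr fun θ hθ => ?_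
      rw [uIcc_of_le two_pi_pos.le] at hθ
      have : (m θ : ℂ) ≠ 0 := by exact_mod_cast hne θ hθ
      push_cast
      field_simp
      ring
    all_goals
      apply ContinuousOn.intervalIntegrable
      rw [uIcc_of_le two_pi_pos.le]
      refine (Complex.continuous_ofReal.comp_continuousOn ?_).mul hec.continuousOn
    · exact hc.continuousOn.inv₀ hne
    · exact (((hc.sub continuous_const).pow 2).continuousOn.mul
        (hc.continuousOn.inv₀ hne)).div_const _
  have hbound : ‖∫ θ in (0:ℝ)..(2 * π), (((m θ)⁻¹ : ℝ) : ℂ) * e θ‖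
      ≤ (2 * D / L ^ 3) * |2 * π - 0| := by
    rw [heq]
    refine intervalIntegral.norm_integral_le_of_norm_le_const fun x hx => ?_
    rw [uIoc_of_le two_pi_pos.le] at hx
    have hx' := Ioc_subset_Icc_self hx
    have hmp : 0 < m x := by linarith [hlow x hx']
    have hex : ‖e x‖ = 1 := by
      rw [he]
      simp only
      rw [Complex.norm_exp]
      simp
    have hD : 0 ≤ D := (sq_nonneg _).trans (hosc x hx')
    rw [norm_mul, hex, mul_one, Complex.norm_real, Real.norm_of_nonneg (by positivity)]
    calc (m x - L) ^ 2 * (m x)⁻¹ / L ^ 2 ≤ D * (L / 2)⁻¹ / L ^ 2 := by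
          gcongr
          · exact hosc x hx'
          · exact hlow x hx'
      _ = 2 * D / L ^ 3 := by field_simp
  rw [fCoeff, norm_mul]
  have h2 : ‖(1 / (2 * (π : ℂ)))‖ = (2 * π)⁻¹ := by
    simp [abs_of_pos pi_pos]
  rw [h2, inv_mul_le_iff₀ two_pi_pos]
  rw [sub_zero, abs_of_pos two_pi_pos] at hbound
  linarith

section TwoVariables

variable {G : ℝ → ℝ → ℝ} {I : Set ℝ}

theorem hasDerivAt_fst_of_contDiffOn
    (hG : ContDiffOn ℝ (⊤ : ℕ∞) (fun q : ℝ × ℝ => G q.1 q.2) (univ ×ˢ I)) (x : ℝ) {t : ℝ}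
    (ht : t ∈ I) :
    HasDerivAt (fun y => G y t)
      (fderivWithin ℝ (fun q : ℝ × ℝ => G q.1 q.2) (univ ×ˢ I) (x, t) (1, 0)) x := by
  have h1 : HasDerivAt (fun y : ℝ => (y, t)) ((1 : ℝ), (0 : ℝ)) x :=
    (hasDerivAt_id x).prodMk (hasDerivAt_const x t)
  exact ((hG.differentiableOn (by simp) (x, t) ⟨mem_univ _, ht⟩).hasFDerivWithinAt).comp_hasDerivAt
    x h1 (Eventually.of_forall fun y => mk_mem_prod (mem_univ _) ht)

theorem hasDerivAt_snd_of_contDiffOn (hI : IsOpen I)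
    (hG : ContDiffOn ℝ (⊤ : ℕ∞) (fun q : ℝ × ℝ => G q.1 q.2) (univ ×ˢ I)) (x : ℝ) {t : ℝ}
    (ht : t ∈ I) :
    HasDerivAt (fun s => G x s)
      (fderivWithin ℝ (fun q : ℝ × ℝ => G q.1 q.2) (univ ×ˢ I) (x, t) (0, 1)) t := by
  have h1 : HasDerivAt (fun s : ℝ => (x, s)) ((0 : ℝ), (1 : ℝ)) t :=
    (hasDerivAt_const t x).prodMk (hasDerivAt_id t)
  exact ((hG.differentiableOn (by simp) (x, t) ⟨mem_univ _, ht⟩).hasFDerivWithinAt).comp_hasDerivAt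
    t h1 ((hI.eventually_mem ht).mono fun s hs => mk_mem_prod (mem_univ _) hs)

theorem contDiffOn_fderivWithin_const_apply (hI : UniqueDiffOn ℝ I)
    (hG : ContDiffOn ℝ (⊤ : ℕ∞) (fun q : ℝ × ℝ => G q.1 q.2) (univ ×ˢ I)) (v : ℝ × ℝ) :
    ContDiffOn ℝ (⊤ : ℕ∞) (fun q : ℝ × ℝ =>
      fderivWithin ℝ (fun q : ℝ × ℝ => G q.1 q.2) (univ ×ˢ I) q v) (univ ×ˢ I) :=
  (hG.fderivWithin (uniqueDiffOn_univ.prod hI) (by simp)).clm_apply contDiffOn_const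

theorem contDiffOn_deriv_fst (hI : UniqueDiffOn ℝ I)
    (hG : ContDiffOn ℝ (⊤ : ℕ∞) (fun q : ℝ × ℝ => G q.1 q.2) (univ ×ˢ I)) :
    ContDiffOn ℝ (⊤ : ℕ∞) (fun q : ℝ × ℝ => deriv (fun y => G y q.2) q.1) (univ ×ˢ I) :=
  (contDiffOn_fderivWithin_const_apply hI hG (1, 0)).congr fun q hq =>
    (hasDerivAt_fst_of_contDiffOn hG q.1 hq.2).deriv

theorem contDiffOn_deriv_snd (hI : IsOpen I)
    (hG : ContDiffOn ℝ (⊤ : ℕ∞) (fun q : ℝ × ℝ => G q.1 q.2) (univ ×ˢ I)) :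
    ContDiffOn ℝ (⊤ : ℕ∞) (fun q : ℝ × ℝ => deriv (fun s => G q.1 s) q.2) (univ ×ˢ I) :=
  (contDiffOn_fderivWithin_const_apply hI.uniqueDiffOn hG (0, 1)).congr fun q hq =>
    (hasDerivAt_snd_of_contDiffOn hI hG q.1 hq.2).deriv

theorem contDiff_slice
    (hG : ContDiffOn ℝ (⊤ : ℕ∞) (fun q : ℝ × ℝ => G q.1 q.2) (univ ×ˢ I)) {t : ℝ} (ht : t ∈ I) :
    ContDiff ℝ (⊤ : ℕ∞) (fun x => G x t) := by
  rw [← contDiffOn_univ]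
  exact hG.comp (f := fun x : ℝ => (x, t)) (by fun_prop) fun x _ => ⟨mem_univ _, ht⟩

theorem deriv_snd_deriv_fst (hI : IsOpen I)
    (hG : ContDiffOn ℝ (⊤ : ℕ∞) (fun q : ℝ × ℝ => G q.1 q.2) (univ ×ˢ I)) (x : ℝ) {t : ℝ}
    (ht : t ∈ I) :
    deriv (fun s => deriv (fun y => G y s) x) t = deriv (fun y => deriv (fun s => G y s) t) x := by
  set F := fun q : ℝ × ℝ => G q.1 q.2 with hF
  have hU : IsOpen ((univ : Set ℝ) ×ˢ I) := isOpen_univ.prod hI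
  have hmem : ((x, t) : ℝ × ℝ) ∈ (univ : Set ℝ) ×ˢ I := ⟨mem_univ _, ht⟩
  have hat : ContDiffAt ℝ (⊤ : ℕ∞) F (x, t) := hG.contDiffAt (hU.mem_nhds hmem)
  have hat2 : ContDiffAt ℝ 2 F (x, t) := contDiffAt_infty.1 hat 2
  have hsymm := hat2.isSymmSndFDerivAt (by simp)
  have hd : HasFDerivAt (fderiv ℝ F) (fderiv ℝ (fderiv ℝ F) (x, t)) (x, t) :=
    ((hat2.fderiv_right (m := 1) (by norm_num)).differentiableAt one_ne_zero).hasFDerivAt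
  have h1 : HasDerivAt (fun y : ℝ => (y, t)) ((1 : ℝ), (0 : ℝ)) x :=
    (hasDerivAt_id x).prodMk (hasDerivAt_const x t)
  have h2 : HasDerivAt (fun s : ℝ => (x, s)) ((0 : ℝ), (1 : ℝ)) t :=
    (hasDerivAt_const t x).prodMk (hasDerivAt_id t)
  have e1 : (fun s => deriv (fun y => G y s) x) =ᶠ[nhds t] fun s => fderiv ℝ F (x, s) (1, 0) := by
    filter_upwards [hI.eventually_mem ht] with s hs
    rw [(hasDerivAt_fst_of_contDiffOn hG x hs).deriv, fderivWithin_of_isOpen hU ⟨mem_univ _, hs⟩]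
  have e2 : (fun y => deriv (fun s => G y s) t) =ᶠ[nhds x] fun y => fderiv ℝ F (y, t) (0, 1) := by
    filter_upwards with y
    rw [(hasDerivAt_snd_of_contDiffOn hI hG y ht).deriv,
      fderivWithin_of_isOpen hU ⟨mem_univ _, ht⟩]
  have d : ∀ v w : ℝ × ℝ, ∀ (c : ℝ → ℝ × ℝ) (r : ℝ), c r = (x, t) → HasDerivAt c w r →
      deriv (fun s => fderiv ℝ F (c s) v) r = fderiv ℝ (fderiv ℝ F) (x, t) w v := by
    intro v w c r hcr hc
    rw [← hcr] at hd
    have h := ((ContinuousLinearMap.apply ℝ ℝ v).hasFDerivAt.comp _ hd).comp_hasDerivAt r hc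
    rw [← hcr]
    exact h.deriv
  rw [e1.deriv_eq, e2.deriv_eq, d _ _ _ t rfl h2,
    d _ _ (fun y => (y, t)) x rfl h1]
  exact hsymm (0, 1) (1, 0)

theorem continuousOn_integral_of_continuousOn {T : ℝ}
    (hG : ContinuousOn (fun q : ℝ × ℝ => G q.1 q.2) (univ ×ˢ Ico 0 T)) (a b : ℝ) :
    ContinuousOn (fun t => ∫ x in a..b, G x t) (Ico 0 T) := by
  intro t ht
  obtain ⟨S, htS, hST⟩ := exists_between ht.2
  have hS0 : 0 ≤ S := ht.1.trans htS.le
  have hpr : ∀ s, max 0 (min s S) ∈ Ico 0 T := fun s =>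
    ⟨le_max_left _ _, max_lt (hS0.trans_lt hST) ((min_le_right _ _).trans_lt hST)⟩
  have hc : Continuous (Function.uncurry fun s x => G x (max 0 (min s S))) :=
    hG.comp_continuous (f := fun q : ℝ × ℝ => (q.2, max 0 (min q.1 S))) (by fun_prop)
      fun q => ⟨mem_univ _, hpr _⟩
  have h := intervalIntegral.continuous_parametric_intervalIntegral_of_continuous' (μ := volume)
    hc a b
  refine h.continuousWithinAt.congr_of_eventuallyEq ?_ ?_
  · filter_upwards [self_mem_nhdsWithin, mem_nhdsWithin_of_mem_nhds (Iio_mem_nhds htS)]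
      with s hs hs'
    rw [min_eq_left (le_of_lt hs'), max_eq_right hs.1]
  · rw [min_eq_left htS.le, max_eq_right ht.1]

theorem hasDerivAt_integral_of_contDiffOn (hI : IsOpen I)
    (hG : ContDiffOn ℝ (⊤ : ℕ∞) (fun q : ℝ × ℝ => G q.1 q.2) (univ ×ˢ I)) {t : ℝ} (ht : t ∈ I)
    (a b : ℝ) :
    HasDerivAt (fun s => ∫ x in a..b, G x s) (∫ x in a..b, deriv (fun s => G x s) t) t := by
  obtain ⟨ε, hε, hball⟩ := Metric.nhds_basis_closedBall.mem_iff.1 (hI.mem_nhds ht)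
  have hG' := contDiffOn_deriv_snd hI hG
  obtain ⟨C, hC⟩ := (isCompact_uIcc (a := a) (b := b)).prod (isCompact_closedBall t ε)
    |>.exists_bound_of_continuousOn (hG'.continuousOn.mono (prod_mono (subset_univ _) hball))
  refine (intervalIntegral.hasDerivAt_integral_of_dominated_loc_of_deriv_le
    (F := fun s x => G x s) (F' := fun s x => deriv (fun s => G x s) s) (bound := fun _ => C)
    (Metric.closedBall_mem_nhds t hε) ?_ ?_ ?_ ?_ ?_ ?_).2
  · filter_upwards [hI.mem_nhds ht] with s hs
    exact (contDiff_slice hG hs).continuous.aestronglyMeasurable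
  · exact (contDiff_slice hG ht).continuous.intervalIntegrable _ _
  · exact (contDiff_slice (G := fun x s => deriv (fun s => G x s) s) hG'
      ht).continuous.aestronglyMeasurable
  · exact Eventually.of_forall fun x hx s hs => hC (x, s) ⟨uIoc_subset_uIcc hx, hs⟩
  · exact intervalIntegrable_const
  · exact Eventually.of_forall fun x _ s hs =>
      (hasDerivAt_snd_of_contDiffOn hI hG x (hball hs)).differentiableAt.hasDerivAt

end TwoVariables

/-- The radius of curvature `m = 1/k` of a smooth closed convex solution of the `p`-curve
shortening flow, as a function of the tangent angle and of time. -/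
structure IsRadiusFlow (p : ℕ) (T : ℝ) (m : ℝ → ℝ → ℝ) : Prop where
  smooth : ContDiffOn ℝ (⊤ : ℕ∞) (fun q : ℝ × ℝ => m q.1 q.2) (univ ×ˢ Ico 0 T)
  periodic : ∀ θ t, m (θ + 2 * π) t = m θ t
  pos : ∀ θ, ∀ t ∈ Ico 0 T, 0 < m θ t
  evolution : ∀ θ, ∀ t ∈ Ico 0 T, HasDerivAt (fun s => m θ s)
    (radiusSpeed p (m θ t) (deriv (fun x => m x t) θ) (deriv (deriv fun x => m x t) θ)) t
  closed : ∀ t ∈ Ico 0 T, ∀ n : ℤ, n = 1 ∨ n = -1 → fCoeff (fun θ => m θ t) n = 0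

/-- The average over the circle of `m(·, t)`. -/
noncomputable def meanRadius (m : ℝ → ℝ → ℝ) (t : ℝ) : ℝ :=
  (2 * π)⁻¹ * ∫ θ in (0:ℝ)..(2 * π), m θ t

/-- The Dirichlet energy of `m(·, t)`. -/
noncomputable def radiusEnergy (m : ℝ → ℝ → ℝ) (t : ℝ) : ℝ :=
  ∫ θ in (0:ℝ)..(2 * π), deriv (fun x => m x t) θ ^ 2

namespace IsRadiusFlow

variable {p : ℕ} {T : ℝ} {m : ℝ → ℝ → ℝ} {t : ℝ}

theorem smooth_deriv (h : IsRadiusFlow p T m) :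
    ContDiffOn ℝ (⊤ : ℕ∞) (fun q : ℝ × ℝ => deriv (fun x => m x q.2) q.1) (univ ×ˢ Ico 0 T) :=
  contDiffOn_deriv_fst (uniqueDiffOn_Ico 0 T) h.smooth

theorem contDiff (h : IsRadiusFlow p T m) (ht : t ∈ Ico 0 T) :
    ContDiff ℝ (⊤ : ℕ∞) (fun x => m x t) := contDiff_slice h.smooth ht

theorem contDiff_deriv (h : IsRadiusFlow p T m) (ht : t ∈ Ico 0 T) :
    ContDiff ℝ (⊤ : ℕ∞) (deriv fun x => m x t) :=
  contDiff_slice (G := fun x s => deriv (fun y => m y s) x) h.smooth_deriv ht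

theorem hasDerivAt (h : IsRadiusFlow p T m) (ht : t ∈ Ico 0 T) (x : ℝ) :
    HasDerivAt (fun x => m x t) (deriv (fun x => m x t) x) x :=
  ((h.contDiff ht).differentiable (by simp) x).hasDerivAt

theorem hasDerivAt_deriv (h : IsRadiusFlow p T m) (ht : t ∈ Ico 0 T) (x : ℝ) :
    HasDerivAt (deriv fun x => m x t) (deriv (deriv fun x => m x t) x) x :=
  ((h.contDiff_deriv ht).differentiable (by simp) x).hasDerivAt

theorem continuous_deriv_deriv (h : IsRadiusFlow p T m) (ht : t ∈ Ico 0 T) :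
    Continuous (deriv (deriv fun x => m x t)) :=
  (h.contDiff_deriv ht).continuous_deriv (by simp)

theorem periodic_deriv (h : IsRadiusFlow p T m) (t x : ℝ) :
    deriv (fun x => m x t) (x + 2 * π) = deriv (fun x => m x t) x := by
  rw [← deriv_comp_add_const]
  simp only [h.periodic]

theorem radiusEnergy_nonneg (m : ℝ → ℝ → ℝ) (t : ℝ) : 0 ≤ radiusEnergy m t :=
  intervalIntegral.integral_nonneg two_pi_pos.le fun _ _ => sq_nonneg _

theorem integral_eq_meanRadius (m : ℝ → ℝ → ℝ) (t : ℝ) :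
    ∫ θ in (0:ℝ)..(2 * π), m θ t = 2 * π * meanRadius m t := by
  rw [meanRadius, mul_inv_cancel_left₀ two_pi_pos.ne']

theorem meanRadius_pos (h : IsRadiusFlow p T m) (ht : t ∈ Ico 0 T) : 0 < meanRadius m t :=
  mul_pos (by positivity) (intervalIntegral.intervalIntegral_pos_of_pos
    ((h.contDiff ht).continuous.intervalIntegrable _ _) (fun x => h.pos x t ht) two_pi_pos)

theorem continuousOn_meanRadius (h : IsRadiusFlow p T m) :
    ContinuousOn (meanRadius m) (Ico 0 T) :=
  (continuousOn_integral_of_continuousOn h.smooth.continuousOn _ _).const_mul _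

theorem continuousOn_radiusEnergy (h : IsRadiusFlow p T m) :
    ContinuousOn (radiusEnergy m) (Ico 0 T) :=
  continuousOn_integral_of_continuousOn (G := fun θ t => deriv (fun x => m x t) θ ^ 2)
    (h.smooth_deriv.continuousOn.pow 2) _ _

theorem hasDerivAt_meanRadius (h : IsRadiusFlow p T m) (ht : t ∈ Ioo 0 T) :
    HasDerivAt (meanRadius m)
      (-((2 * π)⁻¹ * (1 / p * ∫ θ in (0:ℝ)..(2 * π), (m θ t)⁻¹ ^ p))) t := by
  have ht' := Ioo_subset_Ico_self ht
  have hd := hasDerivAt_integral_of_contDiffOn isOpen_Ioo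
    (h.smooth.mono (prod_mono_right Ioo_subset_Ico_self)) ht 0 (2 * π)
  refine (hd.const_mul (2 * π)⁻¹).congr_deriv ?_
  simp only [(h.evolution _ t ht').deriv]
  rw [integral_radiusSpeed (h.hasDerivAt ht') (h.hasDerivAt_deriv ht')
    (h.continuous_deriv_deriv ht') (fun x => h.pos x t ht') (fun x => h.periodic x t)
    (h.periodic_deriv t), mul_neg]

theorem hasDerivAt_radiusEnergy (h : IsRadiusFlow p T m) (ht : t ∈ Ioo 0 T) :
    HasDerivAt (radiusEnergy m) (-2 * ∫ θ in (0:ℝ)..(2 * π), deriv (deriv fun x => m x t) θ *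
      radiusSpeed p (m θ t) (deriv (fun x => m x t) θ) (deriv (deriv fun x => m x t) θ)) t := by
  have ht' := Ioo_subset_Ico_self ht
  have hsub : (univ : Set ℝ) ×ˢ Ioo 0 T ⊆ univ ×ˢ Ico 0 T := prod_mono_right Ioo_subset_Ico_self
  have hd := hasDerivAt_integral_of_contDiffOn (G := fun θ t => deriv (fun x => m x t) θ ^ 2)
    isOpen_Ioo ((h.smooth_deriv.pow 2).mono hsub) ht 0 (2 * π)
  refine hd.congr_deriv ?_
  set g := fun x => deriv (fun s => m x s) t with hg
  have hgeq : ∀ x, g x = radiusSpeed p (m x t) (deriv (fun x => m x t) x)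
      (deriv (deriv fun x => m x t) x) := fun x => (h.evolution x t ht').deriv
  have hgs : ContDiff ℝ (⊤ : ℕ∞) g := contDiff_slice (G := fun x s => deriv (fun s => m x s) s)
    (contDiffOn_deriv_snd isOpen_Ioo (h.smooth.mono hsub)) ht
  have hgd : ∀ x, HasDerivAt g (deriv g x) x := fun x =>
    (hgs.differentiable (by simp) x).hasDerivAt
  have hgc : Continuous (deriv g) := hgs.continuous_deriv (by simp)
  have hgp : ∀ x, g (x + 2 * π) = g x := fun x => by simp only [hg, h.periodic]
  have hm1 : Continuous (deriv fun x => m x t) := (h.contDiff_deriv ht').continuous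
  have hm2 := h.continuous_deriv_deriv ht'
  have hpt : ∀ x, deriv (fun s => deriv (fun y => m y s) x ^ 2) t
      = 2 * (deriv (fun y => m y t) x * deriv g x) := fun x => by
    have hs := deriv_snd_deriv_fst isOpen_Ioo (h.smooth.mono hsub) x ht
    have h1 := (hasDerivAt_snd_of_contDiffOn (G := fun x s => deriv (fun y => m y s) x) isOpen_Ioo
      (h.smooth_deriv.mono hsub) x ht).differentiableAt.hasDerivAt
    have h2 : HasDerivAt (fun s => deriv (fun y => m y s) x ^ 2) _ t := h1.fun_pow 2
    rw [h2.deriv, hs]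
    ring
  have hz := integral_deriv_eq_zero_of_periodic
    (fun x => (h.hasDerivAt_deriv ht' x).fun_mul (hgd x))
    ((hm2.fun_mul hgs.continuous).fun_add (hm1.fun_mul hgc))
    (fun x => by rw [h.periodic_deriv, hgp])
  rw [intervalIntegral.integral_add ((hm2.fun_mul hgs.continuous).intervalIntegrable _ _)
    ((hm1.fun_mul hgc).intervalIntegrable _ _)] at hz
  simp only [hpt, ← hgeq, intervalIntegral.integral_const_mul]
  linarith

/-- The constant `δ` is admissible as a pinching constant. -/
def Pinching (p : ℕ) (δ : ℝ) : Prop := 0 < δ ∧ 2100 * ((p:ℝ) + 1) ^ 2 * δ ≤ 1 ∧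
    ∀ x : ℝ, (x - 1) ^ 2 ≤ δ → 1 / 2 ≤ x ∧ ∀ j ∈ Finset.range (p + 4), |x⁻¹ ^ j - 1| ≤ 1 / 20

variable {δ : ℝ}

theorem sq_sub_meanRadius_le (h : IsRadiusFlow p T m) (ht : t ∈ Ico 0 T) {x : ℝ}
    (hx : x ∈ Icc 0 (2 * π)) : (m x t - meanRadius m t) ^ 2 ≤ 2 * π * radiusEnergy m t :=
  sq_sub_average_le_integral_deriv_sq (h.hasDerivAt ht) (h.contDiff_deriv ht).continuous
    (integral_eq_meanRadius m t) hx

theorem pinched (hδ : Pinching p δ) (h : IsRadiusFlow p T m) (ht : t ∈ Ico 0 T)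
    (hE : 2 * π * radiusEnergy m t ≤ δ * meanRadius m t ^ 2) {x : ℝ}
    (hx : x ∈ Icc 0 (2 * π)) : meanRadius m t / 2 ≤ m x t ∧ ∀ j < p + 4,
      19 / 20 * (meanRadius m t)⁻¹ ^ j ≤ (m x t)⁻¹ ^ j ∧
      (m x t)⁻¹ ^ j ≤ 21 / 20 * (meanRadius m t)⁻¹ ^ j :=
  pow_inv_bounds hδ.2.2 (h.meanRadius_pos ht) ((h.sq_sub_meanRadius_le ht hx).trans hE)

theorem exists_hasDerivAt_meanRadius (hδ : Pinching p δ)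
    (h : IsRadiusFlow p T m) (ht : t ∈ Ioo 0 T)
    (hE : 2 * π * radiusEnergy m t ≤ δ * meanRadius m t ^ 2) :
    ∃ d, HasDerivAt (meanRadius m) (-d) t ∧ p * d ≤ 21 / 20 * (meanRadius m t)⁻¹ ^ p := by
  have ht' := Ioo_subset_Ico_self ht
  refine ⟨_, h.hasDerivAt_meanRadius ht, ?_⟩
  have hc := continuous_inv_pow_of_pos (h.hasDerivAt ht') (fun x => h.pos x t ht') p
  have hmono := intervalIntegral.integral_mono_on (μ := volume) two_pi_pos.le
    (hc.intervalIntegrable _ _) (continuous_const.intervalIntegrable _ _)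
    fun x hx => ((h.pinched hδ ht' hE hx).2 p (by omega)).2
  rw [intervalIntegral.integral_const, sub_zero, smul_eq_mul] at hmono
  rcases p.eq_zero_or_pos with rfl | hp
  · norm_num
  have hp' : (p : ℝ) ≠ 0 := by positivity
  calc _ = (2 * π)⁻¹ * ∫ θ in (0:ℝ)..(2 * π), (m θ t)⁻¹ ^ p := by field_simp
    _ ≤ (2 * π)⁻¹ * (2 * π * (21 / 20 * (meanRadius m t)⁻¹ ^ p)) := by gcongr
    _ = _ := inv_mul_cancel_left₀ two_pi_pos.ne' _

theorem exists_hasDerivAt_ratio (hp : 1 ≤ p) (hδ : Pinching p δ)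
    (h : IsRadiusFlow p T m) (ht : t ∈ Ioo 0 T)
    (hE : 2 * π * radiusEnergy m t ≤ δ * meanRadius m t ^ 2) {q : ℕ} (hq : q ≤ 4 * p) :
    ∃ d, HasDerivAt (fun s => radiusEnergy m s * (meanRadius m s)⁻¹ ^ q) d t ∧
      d ≤ -(9 / 10) * (meanRadius m t)⁻¹ ^ (p + 1)
        * (radiusEnergy m t * (meanRadius m t)⁻¹ ^ q) := by
  have ht' := Ioo_subset_Ico_self ht
  have hL := h.meanRadius_pos ht'
  obtain ⟨d, hd, hdp⟩ := h.exists_hasDerivAt_meanRadius hδ ht hE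
  have hEd := integral_neg_deriv_deriv_mul_radiusSpeed_le hp (h.hasDerivAt ht')
    (h.hasDerivAt_deriv ht') (h.continuous_deriv_deriv ht') (fun x => h.pos x t ht')
    (fun x => h.periodic x t) (h.periodic_deriv t) (h.closed t ht' 1 (Or.inl rfl))
    (h.closed t ht' (-1) (Or.inr rfl)) hL hδ.2.1 (fun x hx => (h.pinched hδ ht' hE hx).2) hE
  refine ⟨_, (h.hasDerivAt_radiusEnergy ht).fun_mul ((hd.fun_inv hL.ne').fun_pow q), ?_⟩
  change _ ≤ -(51 / 10) * (meanRadius m t)⁻¹ ^ (p + 1) * radiusEnergy m t at hEd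
  have hE0 := radiusEnergy_nonneg m t
  have e1 : (q : ℝ) * (meanRadius m t)⁻¹ ^ (q - 1) * (- -d / meanRadius m t ^ 2)
      = q * d * (meanRadius m t)⁻¹ ^ (q + 1) := by
    rcases q with _ | q
    · simp
    rw [add_tsub_cancel_right, pow_add _ (q + 1) 1, pow_add _ q 1]
    field_simp
  rw [e1]
  set l := (meanRadius m t)⁻¹
  have hl : 0 < l := inv_pos.2 hL
  set E := radiusEnergy m t
  have e2 : (q : ℝ) * d ≤ 21 / 5 * l ^ p := by
    rcases le_total d 0 with hd0 | hd0
    · exact (mul_nonpos_of_nonneg_of_nonpos (by positivity) hd0).trans (by positivity)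
    · have : (q : ℝ) ≤ 4 * p := by exact_mod_cast hq
      calc (q : ℝ) * d ≤ 4 * p * d := by gcongr
        _ ≤ _ := by linarith
  have e3 : E * (q * d * l ^ (q + 1)) ≤ E * (21 / 5 * l ^ p * l ^ (q + 1)) := by gcongr
  have e4 := mul_le_mul_of_nonneg_right hEd (pow_pos hl q).le
  refine (add_le_add e4 e3).trans (le_of_eq ?_)
  ring

theorem energy_le_iff (hL : 0 < meanRadius m t) :
    2 * π * radiusEnergy m t ≤ δ * meanRadius m t ^ 2 ↔
      radiusEnergy m t * (meanRadius m t)⁻¹ ^ 2 ≤ δ / (2 * π) := by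
  rw [inv_pow, ← div_eq_mul_inv, div_le_div_iff₀ (by positivity) (by positivity), mul_comm (2 * π)]

/-- Pinching is preserved along the flow. -/
theorem energy_le (hp : 1 ≤ p) (hδ : Pinching p δ) (h : IsRadiusFlow p T m) {a : ℝ} (ha : 0 < a)
    (hE : 2 * π * radiusEnergy m a ≤ δ * meanRadius m a ^ 2) (ht : t ∈ Ico a T) :
    2 * π * radiusEnergy m t ≤ δ * meanRadius m t ^ 2 := by
  have hsub : Icc a t ⊆ Ioo 0 T := fun s hs => ⟨ha.trans_le hs.1, hs.2.trans_lt ht.2⟩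
  have hsub' : Icc a t ⊆ Ico 0 T := hsub.trans Ioo_subset_Ico_self
  have hpos : ∀ s ∈ Icc a t, 0 < meanRadius m s := fun s hs => h.meanRadius_pos (hsub' hs)
  have hd : ∀ s ∈ Icc a t, DifferentiableAt ℝ
      (fun s => radiusEnergy m s * (meanRadius m s)⁻¹ ^ 2) s := fun s hs =>
    ((h.hasDerivAt_radiusEnergy (hsub hs)).fun_mul
      (((h.hasDerivAt_meanRadius (hsub hs)).fun_inv (hpos s hs).ne').fun_pow 2)).differentiableAt
  rw [energy_le_iff (hpos t (right_mem_Icc.2 ht.1))]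
  refine image_le_of_deriv_right_lt_deriv_boundary (B := fun _ => δ / (2 * π)) (B' := fun _ => 0)
    (fun s hs => (hd s hs).continuousAt.continuousWithinAt)
    (fun s hs => (hd s (Ico_subset_Icc_self hs)).hasDerivAt.hasDerivWithinAt)
    ((energy_le_iff (hpos a (left_mem_Icc.2 ht.1))).1 hE) (fun s => hasDerivAt_const _ _) ?_
    (right_mem_Icc.2 ht.1)
  intro s hs hsE
  have hs' := Ico_subset_Icc_self hs
  obtain ⟨d, hd1, hd2⟩ := h.exists_hasDerivAt_ratio hp hδ (hsub hs')
    ((energy_le_iff (hpos s hs')).2 hsE.le) (q := 2) (by omega)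
  rw [hd1.deriv]
  rw [hsE] at hd2
  have hl : 0 < (meanRadius m s)⁻¹ := inv_pos.2 (hpos s hs')
  have hδ0 := hδ.1
  refine hd2.trans_lt ?_
  rw [neg_mul, neg_mul, neg_lt_zero]
  positivity

theorem energy_mul_le (hp : 1 ≤ p) (hδ : Pinching p δ) (h : IsRadiusFlow p T m) {a : ℝ}
    (ha : 0 < a) (hE : 2 * π * radiusEnergy m a ≤ δ * meanRadius m a ^ 2) {q : ℕ}
    (hq : q ≤ 4 * p) (ht : t ∈ Ico a T) :
    radiusEnergy m t * (meanRadius m t)⁻¹ ^ q ≤ radiusEnergy m a * (meanRadius m a)⁻¹ ^ q := by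
  have key : ∀ s ∈ Icc a t, ∃ d ≤ 0,
      HasDerivAt (fun s => radiusEnergy m s * (meanRadius m s)⁻¹ ^ q) d s := fun s hs => by
    have hs' : s ∈ Ioo 0 T := ⟨ha.trans_le hs.1, hs.2.trans_lt ht.2⟩
    obtain ⟨d, hd1, hd2⟩ := h.exists_hasDerivAt_ratio hp hδ hs'
      (h.energy_le hp hδ ha hE ⟨hs.1, hs.2.trans_lt ht.2⟩) hq
    refine ⟨d, hd2.trans ?_, hd1⟩
    have hl : 0 < (meanRadius m s)⁻¹ := inv_pos.2 (h.meanRadius_pos (Ioo_subset_Ico_self hs'))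
    have := radiusEnergy_nonneg m s
    rw [neg_mul, neg_mul, neg_nonpos]
    positivity
  refine antitoneOn_of_deriv_nonpos (f := fun s => radiusEnergy m s * (meanRadius m s)⁻¹ ^ q)
    (convex_Icc a t) (fun s hs => ?_) (fun s hs => ?_) (fun s hs => ?_)
    (left_mem_Icc.2 ht.1) (right_mem_Icc.2 ht.1) ht.1
  · obtain ⟨d, -, hd⟩ := key s hs
    exact hd.continuousAt.continuousWithinAt
  · obtain ⟨d, -, hd⟩ := key s (interior_subset hs)
    exact hd.differentiableAt.differentiableWithinAt
  · obtain ⟨d, hd0, hd⟩ := key s (interior_subset hs)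
    rwa [hd.deriv]

theorem meanRadius_pow_le (hp : 1 ≤ p) (hδ : Pinching p δ) (h : IsRadiusFlow p T m) {a : ℝ}
    (ha : 0 < a) (hE : 2 * π * radiusEnergy m a ≤ δ * meanRadius m a ^ 2) (ht : t ∈ Ico a T)
    (hlim : Tendsto (meanRadius m) (nhdsWithin T (Iio T)) (nhds 0)) :
    meanRadius m t ^ (p + 1) ≤ 21 / 10 * (T - t) := by
  have key : ∀ s ∈ Ico a T, ∃ d ≥ 0,
      HasDerivAt (fun s => meanRadius m s ^ (p + 1) + 21 / 10 * s) d s := fun s hs => by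
    have hs' : s ∈ Ioo 0 T := ⟨ha.trans_le hs.1, hs.2⟩
    have hL := h.meanRadius_pos (Ioo_subset_Ico_self hs')
    obtain ⟨d, hd, hdp⟩ := h.exists_hasDerivAt_meanRadius hδ hs' (h.energy_le hp hδ ha hE hs)
    refine ⟨_, ?_, (hd.fun_pow (p + 1)).fun_add ((hasDerivAt_id s).const_mul (21 / 10))⟩
    have h1 : meanRadius m s ^ p * (p * d) ≤ 21 / 20 := by
      calc _ ≤ meanRadius m s ^ p * (21 / 20 * (meanRadius m s)⁻¹ ^ p) := by gcongr
        _ = 21 / 20 := by rw [inv_pow]; field_simp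
    have h2 : meanRadius m s ^ p * d ≤ 21 / 20 := by
      rcases le_total d 0 with hd0 | hd0
      · exact (mul_nonpos_of_nonneg_of_nonpos (by positivity) hd0).trans (by norm_num)
      · refine le_trans ?_ h1
        gcongr
        exact le_mul_of_one_le_left hd0 (by exact_mod_cast hp)
    rw [add_tsub_cancel_right]
    push_cast
    linarith
  have hmono : MonotoneOn (fun s => meanRadius m s ^ (p + 1) + 21 / 10 * s) (Ico a T) := by
    refine monotoneOn_of_deriv_nonneg (convex_Ico a T) (fun s hs => ?_) (fun s hs => ?_)
      (fun s hs => ?_)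
    · obtain ⟨d, -, hd⟩ := key s hs
      exact hd.continuousAt.continuousWithinAt
    · obtain ⟨d, -, hd⟩ := key s (interior_subset hs)
      exact hd.differentiableAt.differentiableWithinAt
    · obtain ⟨d, hd0, hd⟩ := key s (interior_subset hs)
      rwa [hd.deriv]
  have hlim' : Tendsto (fun s => meanRadius m s ^ (p + 1) + 21 / 10 * s)
      (nhdsWithin T (Iio T)) (nhds (0 ^ (p + 1) + 21 / 10 * T)) :=
    (hlim.pow (p + 1)).add
      ((tendsto_id.mono_left nhdsWithin_le_nhds).const_mul (21 / 10))
  have hle := ge_of_tendsto hlim' (b := meanRadius m t ^ (p + 1) + 21 / 10 * t) (by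
    filter_upwards [Ioo_mem_nhdsLT ht.2] with s hs
    exact hmono ht ⟨ht.1.trans hs.1.le, hs.2⟩ hs.1.le)
  rw [zero_pow (by omega)] at hle
  linarith

theorem tendsto_meanRadius (hp : 1 ≤ p) (hδ : Pinching p δ) (h : IsRadiusFlow p T m) {a : ℝ}
    (ha : 0 < a) (haT : a < T) (hE : 2 * π * radiusEnergy m a ≤ δ * meanRadius m a ^ 2)
    (hblow : Tendsto (fun t => ⨆ θ : Icc (0:ℝ) (2 * π), (m θ t)⁻¹)
      (nhdsWithin T (Iio T)) atTop) :
    Tendsto (meanRadius m) (nhdsWithin T (Iio T)) (nhds 0) := by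
  have hinv : Tendsto (fun t => (⨆ θ : Icc (0:ℝ) (2 * π), (m θ t)⁻¹)⁻¹ * 2)
      (nhdsWithin T (Iio T)) (nhds 0) := by
    simpa using (tendsto_inv_atTop_zero.comp hblow).mul_const 2
  have hmem : ∀ᶠ s in nhdsWithin T (Iio T), s ∈ Ioo a T := Ioo_mem_nhdsLT haT
  refine tendsto_of_tendsto_of_tendsto_of_le_of_le' tendsto_const_nhds hinv ?_ ?_
  · filter_upwards [hmem] with s hs
    exact (h.meanRadius_pos ⟨(ha.trans hs.1).le, hs.2⟩).le
  · filter_upwards [hmem, hblow.eventually_gt_atTop 0] with s hs hs0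
    have hs' : s ∈ Ico 0 T := ⟨(ha.trans hs.1).le, hs.2⟩
    have hL := h.meanRadius_pos hs'
    have : Nonempty (Icc (0:ℝ) (2 * π)) := ⟨⟨0, left_mem_Icc.2 two_pi_pos.le⟩⟩
    have hle : (⨆ θ : Icc (0:ℝ) (2 * π), (m θ s)⁻¹) ≤ 2 / meanRadius m s := by
      refine ciSup_le fun θ => ?_
      rw [← inv_div]
      exact inv_anti₀ (by positivity)
        (h.pinched hδ hs' (h.energy_le hp hδ ha hE ⟨hs.1.le, hs.2⟩) θ.2).1
    rw [le_div_iff₀ hL] at hle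
    rw [inv_mul_eq_div, le_div_iff₀ hs0]
    linarith

theorem norm_fCoeff_inv_le_rpow (hp : 1 ≤ p) (hδ : Pinching p δ) (h : IsRadiusFlow p T m) {a : ℝ}
    (ha : 0 < a) (haT : a < T) (hE : 2 * π * radiusEnergy m a ≤ δ * meanRadius m a ^ 2)
    (hblow : Tendsto (fun t => ⨆ θ : Icc (0:ℝ) (2 * π), (m θ t)⁻¹)
      (nhdsWithin T (Iio T)) atTop) :
    ∃ C > 0, ∀ t ∈ Ico a T, ∀ n : ℤ, n = 1 ∨ n = -1 →
      ‖fCoeff (fun θ => (m θ t)⁻¹) n‖ ≤ C * (T - t) ^ ((3 * (p : ℝ) - 2) / ((p : ℝ) + 1)) := by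
  set e := (3 * (p : ℝ) - 2) / ((p : ℝ) + 1) with he
  have hp1 : (1:ℝ) ≤ p := by exact_mod_cast hp
  have he0 : 0 ≤ e := div_nonneg (by linarith) (by linarith)
  set C₀ := radiusEnergy m a * (meanRadius m a)⁻¹ ^ (3 * p + 1) with hC₀
  have hLa := h.meanRadius_pos ⟨ha.le, haT⟩
  have hC₀0 : 0 ≤ C₀ := mul_nonneg (radiusEnergy_nonneg m a) (by positivity)
  refine ⟨4 * π * C₀ * (21 / 10) ^ e + 1, by positivity, fun t ht n hn => ?_⟩
  have ht' : t ∈ Ico 0 T := ⟨ha.le.trans ht.1, ht.2⟩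
  have hL := h.meanRadius_pos ht'
  have hTt : 0 < T - t := sub_pos.2 ht.2
  have hEt := h.energy_le hp hδ ha hE ht
  have h1 := norm_fCoeff_inv_le (h.contDiff ht').continuous hL
    (fun x hx => (h.pinched hδ ht' hEt hx).1) (fun x hx => h.sq_sub_meanRadius_le ht' hx)
    (n := n) (by rcases hn with rfl | rfl <;> norm_num) (h.closed t ht' n hn)
  have h2 := h.energy_mul_le hp hδ ha hE (q := 3 * p + 1) (by omega) ht
  have h3 := h.meanRadius_pow_le hp hδ ha hE ht (h.tendsto_meanRadius hp hδ ha haT hE hblow)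
  have h4 : meanRadius m t ^ (3 * p - 2) = (meanRadius m t ^ (p + 1)) ^ e := by
    rw [← Real.rpow_natCast, ← Real.rpow_natCast, ← Real.rpow_mul hL.le]
    congr 1
    rw [he, Nat.cast_sub (by omega)]
    push_cast
    field_simp
  have h5 : (meanRadius m t ^ (p + 1)) ^ e ≤ (21 / 10) ^ e * (T - t) ^ e := by
    rw [← Real.mul_rpow (by norm_num) hTt.le]
    exact Real.rpow_le_rpow (by positivity) h3 he0
  rw [inv_pow, ← div_eq_mul_inv, div_le_iff₀ (by positivity)] at h2
  calc _ ≤ 2 * (2 * π * radiusEnergy m t) / meanRadius m t ^ 3 := h1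
    _ ≤ 2 * (2 * π * (C₀ * meanRadius m t ^ (3 * p + 1))) / meanRadius m t ^ 3 := by gcongr
    _ = 4 * π * C₀ * meanRadius m t ^ (3 * p - 2) := by
      rw [show 3 * p + 1 = (3 * p - 2) + 3 by omega, pow_add]
      field_simp
      ring
    _ ≤ 4 * π * C₀ * ((21 / 10) ^ e * (T - t) ^ e) := by rw [h4]; gcongr
    _ ≤ (4 * π * C₀ * (21 / 10) ^ e + 1) * (T - t) ^ e := by
      have := Real.rpow_nonneg hTt.le e
      linarith

end IsRadiusFlow

theorem radiusSpeed_inv {p : ℕ} (hp : 1 ≤ p) {K : ℝ} (hK : 0 < K) (K₁ K₂ : ℝ) :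
    radiusSpeed p K⁻¹ (-K₁ / K ^ 2) (-K₂ / K ^ 2 + 2 * K₁ ^ 2 / K ^ 3)
      = -(K ^ 2 * (K ^ (p - 1) * K₂ + ((p:ℝ) - 1) * K ^ (p - 2) * K₁ ^ 2 + 1 / (p:ℝ) * K ^ p))
        / K ^ 2 := by
  rw [radiusSpeed, inv_inv]
  obtain _ | _ | q := p
  · omega
  · norm_num
    field_simp
    ring
  · simp only [add_tsub_cancel_right, show q + 1 + 1 - 2 = q by omega]
    push_cast
    field_simp
    ring

theorem IsPCSF.isRadiusFlow {p : ℕ} {T : ℝ} {k : ℝ → ℝ → ℝ} {ψ : ℝ → ℝ} (hp : 1 ≤ p)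
    (h : IsPCSF p T k ψ) : IsRadiusFlow p T fun θ t => (k θ t)⁻¹ := by
  obtain ⟨hs, hper, hpos, hev, -, -, -, -, -, hcl⟩ := h
  refine ⟨hs.inv fun q hq => (hpos q.1 q.2 hq.2).ne', fun θ t => by rw [hper],
    fun θ t ht => inv_pos.2 (hpos θ t ht), fun θ t ht => ?_, fun t ht n hn => ?_⟩
  · have hk : ContDiff ℝ (⊤ : ℕ∞) fun x => k x t := contDiff_slice hs ht
    have hk1 : ∀ x, HasDerivAt (fun x => k x t) (deriv (fun x => k x t) x) x := fun x =>
      (hk.differentiable (by simp) x).hasDerivAt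
    have hk2 : HasDerivAt (deriv fun x => k x t) (deriv (deriv fun x => k x t) θ) θ :=
      ((hk.iterate_deriv 1).differentiable (by simp) θ).hasDerivAt
    have hne : ∀ x, k x t ≠ 0 := fun x => (hpos x t ht).ne'
    have hm1 : (deriv fun x => (k x t)⁻¹) = fun x => -deriv (fun x => k x t) x / k x t ^ 2 :=
      funext fun x => ((hk1 x).fun_inv (hne x)).deriv
    have hm2 := (hk2.fun_neg.fun_div ((hk1 θ).fun_pow 2) (pow_ne_zero 2 (hne θ))).deriv
    refine ((hev θ t ht).fun_inv (hne θ)).congr_deriv ?_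
    rw [← radiusSpeed_inv hp (hpos θ t ht), hm1, hm2]
    congr 1
    have := hne θ
    field_simp
    ring
  · have hexp : ∫ θ in (0:ℝ)..(2 * π), (((k θ t)⁻¹ : ℝ) : ℂ) * Complex.exp (Complex.I * θ) = 0 := by
      rw [← hcl t ht]
      refine intervalIntegral.integral_congr fun θ _ => ?_
      simp only [Complex.ofReal_inv]
      ring
    rcases hn with rfl | rfl
    · have hconj : ∫ θ in (0:ℝ)..(2 * π), (((k θ t)⁻¹ : ℝ) : ℂ) *
          Complex.exp (-(Complex.I * (1 : ℤ) * θ)) = (starRingEnd ℂ)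
            (∫ θ in (0:ℝ)..(2 * π), (((k θ t)⁻¹ : ℝ) : ℂ) * Complex.exp (Complex.I * θ)) := by
        rw [intervalIntegral.integral_of_le two_pi_pos.le,
          intervalIntegral.integral_of_le two_pi_pos.le, ← integral_conj]
        refine integral_congr_ae (ae_of_all _ fun θ => ?_)
        simp [← Complex.exp_conj]
      rw [fCoeff, hconj, hexp, map_zero, mul_zero]
    · rw [fCoeff]
      simp only [Int.cast_neg, Int.cast_one, mul_neg, mul_one, neg_mul, neg_neg]
      rw [hexp, mul_zero]

theorem re_fCoeff_zero (f : ℝ → ℝ) :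
    (fCoeff f 0).re = (2 * π)⁻¹ * ∫ θ in (0:ℝ)..(2 * π), f θ := by
  have : fCoeff f 0 = (((2 * π)⁻¹ * ∫ θ in (0:ℝ)..(2 * π), f θ : ℝ) : ℂ) := by
    simp [fCoeff, intervalIntegral.integral_ofReal]
  rw [this, Complex.ofReal_re]

theorem seminorm2_nonneg (f : ℝ → ℝ) : 0 ≤ seminorm2 f :=
  le_max_of_le_left (Real.iSup_nonneg fun _ => by positivity)

/-- A positive function whose oscillation is controlled by its Dirichlet energy has a pinched
reciprocal. -/
theorem integral_deriv_inv_sq_lt {f f' : ℝ → ℝ} (hf : ∀ x, HasDerivAt f (f' x) x)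
    (hf' : Continuous f') (hpos : ∀ x, 0 < f x) {c δ : ℝ} (hc : 0 < c) (hδ : 0 < δ)
    (hmean : ∫ θ in (0:ℝ)..(2 * π), f θ = 2 * π * c)
    (h1 : 4 * (2 * π * ∫ θ in (0:ℝ)..(2 * π), f' θ ^ 2) ≤ c ^ 2)
    (h2 : 72 * (2 * π * ∫ θ in (0:ℝ)..(2 * π), f' θ ^ 2) ≤ δ * c ^ 2) :
    2 * π * ∫ θ in (0:ℝ)..(2 * π), (-f' θ / f θ ^ 2) ^ 2
      < δ * ((2 * π)⁻¹ * ∫ θ in (0:ℝ)..(2 * π), (f θ)⁻¹) ^ 2 := by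
  have hfc : Continuous f := continuous_iff_continuousAt.2 fun x => (hf x).continuousAt
  have hbd : ∀ x ∈ Icc 0 (2 * π), c / 2 ≤ f x ∧ f x ≤ 3 * c / 2 := fun x hx => by
    have hsq : (f x - c) ^ 2 ≤ (c / 2) ^ 2 := by
      linarith [sq_sub_average_le_integral_deriv_sq hf hf' hmean hx]
    have habs := abs_le.1 (abs_le_of_sq_le_sq hsq (by positivity))
    constructor <;> linarith [habs.1, habs.2]
  have hE : ∫ θ in (0:ℝ)..(2 * π), (-f' θ / f θ ^ 2) ^ 2
      ≤ ∫ θ in (0:ℝ)..(2 * π), 16 / c ^ 4 * f' θ ^ 2 := by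
    refine intervalIntegral.integral_mono_on two_pi_pos.le
      (((hf'.neg.div (hfc.pow 2) fun x => (pow_pos (hpos x) 2).ne').pow 2).intervalIntegrable _ _)
      ((continuous_const.mul (hf'.pow 2)).intervalIntegrable _ _) fun x hx => ?_
    have h4 : (c / 2) ^ 4 ≤ f x ^ 4 := pow_le_pow_left₀ (by positivity) (hbd x hx).1 4
    calc (-f' x / f x ^ 2) ^ 2 = f' x ^ 2 / f x ^ 4 := by
          rw [div_pow, neg_sq, ← pow_mul]
      _ ≤ f' x ^ 2 / (c / 2) ^ 4 := by gcongr
      _ = _ := by field_simp; norm_num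
  have hL : 2 / (3 * c) ≤ (2 * π)⁻¹ * ∫ θ in (0:ℝ)..(2 * π), (f θ)⁻¹ := by
    have hmono := intervalIntegral.integral_mono_on (μ := volume) two_pi_pos.le
      (continuous_const.intervalIntegrable _ _)
      ((hfc.inv₀ fun x => (hpos x).ne').intervalIntegrable _ _) fun x hx =>
        inv_anti₀ (hpos x) (hbd x hx).2
    rw [intervalIntegral.integral_const, sub_zero, smul_eq_mul, inv_div] at hmono
    rwa [le_inv_mul_iff₀ two_pi_pos]
  rw [intervalIntegral.integral_const_mul] at hE
  calc _ ≤ 2 * π * (16 / c ^ 4 * ∫ θ in (0:ℝ)..(2 * π), f' θ ^ 2) := by gcongr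
    _ = 16 / c ^ 4 * (2 * π * ∫ θ in (0:ℝ)..(2 * π), f' θ ^ 2) := by ring
    _ ≤ 16 / c ^ 4 * (δ * c ^ 2 / 72) := by
      gcongr
      linarith
    _ < δ * (2 / (3 * c)) ^ 2 := by
      have : 0 < δ / c ^ 2 := by positivity
      have e1 : 16 / c ^ 4 * (δ * c ^ 2 / 72) = 2 / 9 * (δ / c ^ 2) := by field_simp; norm_num
      have e2 : δ * (2 / (3 * c)) ^ 2 = 4 / 9 * (δ / c ^ 2) := by field_simp; norm_num
      linarith
    _ ≤ _ := by gcongr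

theorem exists_const_integral_deriv_inv_sq_lt {δ : ℝ} (hδ : 0 < δ) :
    ∃ C > (0:ℝ), ∀ f : ℝ → ℝ, ContDiff ℝ (⊤ : ℕ∞) f → (∀ x, 0 < f x) →
      (∀ x, f (x + 2 * π) = f x) → C * seminorm2 f ≤ (fCoeff f 0).re →
      2 * π * ∫ θ in (0:ℝ)..(2 * π), deriv (fun x => (f x)⁻¹) θ ^ 2
        < δ * ((2 * π)⁻¹ * ∫ θ in (0:ℝ)..(2 * π), (f θ)⁻¹) ^ 2 := by
  set Z : ℝ := ∑' n : ℤ, 1 / (n:ℝ) ^ 2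
  have hZ : 0 ≤ Z := tsum_nonneg fun _ => by positivity
  set B : ℝ := 8 * π ^ 2 * Z * (4 + 72 / δ) + 1 with hB
  have hB0 : 0 < B := by positivity
  refine ⟨√B, Real.sqrt_pos.2 hB0, fun f hf hpos hper hle => ?_⟩
  have hd : ∀ x, HasDerivAt f (deriv f x) x := fun x =>
    (hf.differentiable (by simp) x).hasDerivAt
  have hf1 : ContDiff ℝ (⊤ : ℕ∞) (deriv f) := hf.iterate_deriv 1
  have hper' : ∀ x, deriv f (x + 2 * π) = deriv f x := fun x => by
    rw [← deriv_comp_add_const]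
    simp only [hper]
  have hP := integral_deriv_sq_le_seminorm2_sq hd
    (fun x => (hf1.differentiable (by simp) x).hasDerivAt) (hf1.continuous_deriv (by simp))
    hper hper'
  set c := (fCoeff f 0).re
  set S := seminorm2 f
  have hS : 0 ≤ S := seminorm2_nonneg f
  have hmean : ∫ θ in (0:ℝ)..(2 * π), f θ = 2 * π * c := by
    simp only [c, re_fCoeff_zero, mul_inv_cancel_left₀ two_pi_pos.ne']
  have hc : 0 < c := by
    have := intervalIntegral.intervalIntegral_pos_of_pos
      (hf.continuous.intervalIntegrable 0 (2 * π)) hpos two_pi_pos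
    rw [hmean] at this
    exact pos_of_mul_pos_right this two_pi_pos.le
  have hSc : B * S ^ 2 ≤ c ^ 2 := by
    rw [← Real.sq_sqrt hB0.le, ← mul_pow]
    exact pow_le_pow_left₀ (by positivity) hle 2
  have hA : 2 * π * ∫ θ in (0:ℝ)..(2 * π), deriv f θ ^ 2 ≤ 8 * π ^ 2 * Z * S ^ 2 := by
    calc _ ≤ 2 * π * (4 * π * Z * S ^ 2) := by gcongr
      _ = _ := by ring
  have hW : 0 ≤ 8 * π ^ 2 * Z * S ^ 2 := by positivity
  have hWd : 0 ≤ 72 * (8 * π ^ 2 * Z * S ^ 2) / δ := by positivity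
  have hsplit : 4 * (8 * π ^ 2 * Z * S ^ 2) + 72 * (8 * π ^ 2 * Z * S ^ 2) / δ + S ^ 2
      = B * S ^ 2 := by
    rw [hB]
    ring
  have hderiv : (deriv fun x => (f x)⁻¹) = fun x => -deriv f x / f x ^ 2 :=
    funext fun x => ((hd x).fun_inv (hpos x).ne').deriv
  simp only [hderiv]
  refine integral_deriv_inv_sq_lt hd hf1.continuous hpos hc hδ hmean ?_ ?_
  · nlinarith [sq_nonneg S]
  · have : 72 * (8 * π ^ 2 * Z * S ^ 2) / δ ≤ c ^ 2 := by nlinarith [sq_nonneg S]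
    rw [div_le_iff₀ hδ] at this
    linarith

/-- There is `c_p > 0` depending only on `p` such that if `ψ̂(0) ≥ c_p ‖ψ‖₂`,
then there is `C > 0` with `|k̂(±1,t)| ≤ C (T-t)^{(3p-2)/(p+1)}` for all `t ∈ (T/2,T)`. -/
theorem statement11 (p : ℕ) (hp : 1 ≤ p) :
    ∃ cp > (0:ℝ), ∀ (T : ℝ), 0 < T → ∀ (k : ℝ → ℝ → ℝ) (ψ : ℝ → ℝ),
      IsPCSF p T k ψ →
      cp * seminorm2 ψ ≤ (fCoeff ψ 0).re →
      ∃ C > (0:ℝ), ∀ t : ℝ, T / 2 < t → t < T →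
        ‖fCoeff (fun θ => k θ t) 1‖
          ≤ C * (T - t) ^ ((3 * (p : ℝ) - 2) / ((p : ℝ) + 1)) ∧
        ‖fCoeff (fun θ => k θ t) (-1)‖
          ≤ C * (T - t) ^ ((3 * (p : ℝ) - 2) / ((p : ℝ) + 1)) := by
  obtain ⟨δ, hδ0, hδ⟩ := exists_pinching_const p
  obtain ⟨cp, hcp, hinit⟩ := exists_const_integral_deriv_inv_sq_lt hδ0
  refine ⟨cp, hcp, fun T hT k ψ h hψ => ?_⟩
  have hm := h.isRadiusFlow hp
  obtain ⟨-, -, -, -, hk0, hψs, hψpos, hψper, hblow, -⟩ := h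
  set m : ℝ → ℝ → ℝ := fun θ t => (k θ t)⁻¹ with hmdef
  have h0 : 2 * π * radiusEnergy m 0 < δ * meanRadius m 0 ^ 2 := by
    have := hinit ψ hψs hψpos hψper hψ
    simpa only [radiusEnergy, meanRadius, hmdef, hk0] using this
  have h0mem : (0:ℝ) ∈ Ico 0 T := left_mem_Ico.2 hT
  have hev : ∀ᶠ a in nhdsWithin 0 (Ico 0 T),
      2 * π * radiusEnergy m a < δ * meanRadius m a ^ 2 :=
    ((hm.continuousOn_radiusEnergy 0 h0mem).const_mul (2 * π)).eventually_lt
      (((hm.continuousOn_meanRadius 0 h0mem).pow 2).const_mul δ) h0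
  have hev' : ∀ᶠ a in nhdsWithin (0:ℝ) (Ioi 0),
      2 * π * radiusEnergy m a < δ * meanRadius m a ^ 2 := by
    rw [nhdsWithin_Ico_eq_nhdsGE hT] at hev
    exact hev.filter_mono (nhdsWithin_mono 0 Ioi_subset_Ici_self)
  obtain ⟨a, haE, ha⟩ := (hev'.and (Ioo_mem_nhdsGT (half_pos hT))).exists
  obtain ⟨C, hC, hbound⟩ := hm.norm_fCoeff_inv_le_rpow hp ⟨hδ0, hδ⟩ ha.1
    (ha.2.trans (half_lt_self hT)) haE.le (by simpa only [hmdef, inv_inv] using hblow)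
  simp only [hmdef, inv_inv] at hbound
  refine ⟨C, hC, fun t ht htT => ?_⟩
  have ht' : t ∈ Ico a T := ⟨(ha.2.trans ht).le, htT⟩
  exact ⟨hbound t ht' 1 (Or.inl rfl), hbound t ht' (-1) (Or.inr rfl)⟩
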